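/- Let n ≥ 3 and 0 ≤ p < 1. Then there is no positive function u ∈ C^∞(ℝⁿ) satisfying the Matukuma equation −Δu(x) = u(x)^p/(1+|x|²) for all x ∈ ℝⁿ. -/

import Mathlib

open scoped BigOperators

/-- The Euclidean Laplacian of `u : ℝⁿ → ℝ` at `x`, as the sum of the pure second
derivatives in the standard coordinate directions. -/
noncomputable def eLaplacian {n : ℕ} (u : EuclideanSpace ℝ (Fin n) → ℝ)
    (x : EuclideanSpace ℝ (Fin n)) : ℝ :=
  ∑ i : Fin n, iteratedFDeriv ℝ 2 u x ![EuclideanSpace.single i 1, EuclideanSpace.single i 1]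

open Filter Topology

/-- Second-order necessary condition for a local minimum on the real line. -/
theorem IsLocalMin.hasDerivAt_hasDerivAt_nonneg {g g' : ℝ → ℝ} {t a : ℝ} (hmin : IsLocalMin g t)
    (hg : ∀ s, HasDerivAt g (g' s) s) (hg' : HasDerivAt g' a t) : 0 ≤ a := by
  by_contra! ha
  have hd : deriv g = g' := funext fun s => (hg s).deriv
  have hmax : IsLocalMax g t :=
    isLocalMax_of_deriv_deriv_neg (by rwa [hd, hg'.deriv]) hmin.deriv_eq_zero
      (hg t).continuousAt
  have hconst : g =ᶠ[𝓝 t] fun _ => g t := by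
    filter_upwards [hmin, hmax] with s h₁ h₂ using le_antisymm h₂ h₁
  have h := hconst.deriv.deriv_eq
  rw [hd, hg'.deriv] at h
  simp at h
  exact ha.ne h

theorem hasDerivAt_one_add_quadratic (x r s : ℝ) :
    HasDerivAt (fun s : ℝ => 1 + (r + 2 * s * x + s ^ 2)) (2 * x + 2 * s) s := by
  have h1 : HasDerivAt (fun s : ℝ => r + 2 * s * x) (2 * x) s := by
    simpa using (((hasDerivAt_id s).const_mul 2).mul_const x).const_add r
  have h2 : HasDerivAt (fun s : ℝ => s ^ 2) (2 * s) s := by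
    simpa using hasDerivAt_pow 2 s
  exact (h1.fun_add h2).const_add 1

theorem hasDerivAt_rpow_div_add_log {p c x r : ℝ} (hp : p < 1) {f f' : ℝ → ℝ}
    (hf : ∀ s, 0 < f s) (hf' : ∀ s, HasDerivAt f (f' s) s) (s : ℝ)
    (hr : 0 < 1 + (r + 2 * s * x + s ^ 2)) :
    HasDerivAt (fun s => f s ^ (1 - p) / (1 - p) + c * Real.log (1 + (r + 2 * s * x + s ^ 2)))
      (f s ^ (-p) * f' s + c * ((2 * x + 2 * s) / (1 + (r + 2 * s * x + s ^ 2)))) s := by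
  have h1 := ((hf' s).rpow_const (p := 1 - p) (Or.inl (hf s).ne')).div_const (1 - p)
  have h2 := hasDerivAt_one_add_quadratic x r s
  refine (h1.fun_add ((h2.log hr.ne').const_mul c)).congr_deriv ?_
  have : 1 - p ≠ 0 := by linarith
  rw [show 1 - p - 1 = -p by ring]
  field_simp

/-- If `f ^ (1 - p) / (1 - p) + c log (1 + r + 2 s x + s²)` has a local minimum at `s = 0`,
then `f''(0)` is bounded below. -/
theorem nonneg_of_isLocalMin_rpow_div_add_log {p c x r a : ℝ} (hp0 : 0 ≤ p) (hp : p < 1)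
    (hc : 0 ≤ c) {f f' : ℝ → ℝ}
    (hf : ∀ s, 0 < f s) (hf' : ∀ s, HasDerivAt f (f' s) s) (hf'' : HasDerivAt f' a 0)
    (hr : ∀ s : ℝ, 0 < 1 + (r + 2 * s * x + s ^ 2))
    (hmin : IsLocalMin
      (fun s => f s ^ (1 - p) / (1 - p) + c * Real.log (1 + (r + 2 * s * x + s ^ 2))) 0) :
    0 ≤ f 0 ^ (-p) * a + 2 * c / (1 + r) := by
  have hr0 : 0 < 1 + r := by simpa using hr 0
  have h1 := (hf' 0).rpow_const (p := -p) (Or.inl (hf 0).ne')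
  have h2 := hasDerivAt_one_add_quadratic x r 0
  have h3 : HasDerivAt (fun s : ℝ => 2 * x + 2 * s) 2 0 := by
    simpa using ((hasDerivAt_id (0 : ℝ)).const_mul 2).const_add (2 * x)
  have h4 := (h1.mul hf'').add ((h3.div h2 (hr 0).ne').const_mul c)
  have h := hmin.hasDerivAt_hasDerivAt_nonneg
    (fun s => hasDerivAt_rpow_div_add_log hp hf hf' s (hr s)) h4
  refine h.trans ?_
  have e1 : 0 ≤ p * f 0 ^ (-p - 1) * f' 0 ^ 2 := by
    have := Real.rpow_pos_of_pos (hf 0) (-p - 1)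
    positivity
  have e2 : c * ((2 * (1 + r) - 2 * x * (2 * x)) / (1 + r) ^ 2) ≤ 2 * c / (1 + r) := by
    have : 2 * c / (1 + r) - c * ((2 * (1 + r) - 2 * x * (2 * x)) / (1 + r) ^ 2)
        = c * (2 * x) ^ 2 / (1 + r) ^ 2 := by
      field_simp
      ring
    have : 0 ≤ c * (2 * x) ^ 2 / (1 + r) ^ 2 := by positivity
    linarith
  simp only [mul_zero, zero_mul, add_zero, ne_eq, OfNat.ofNat_ne_zero, not_false_eq_true,
    zero_pow] at *
  nlinarith

theorem stmt12 (n : ℕ) (hn : 3 ≤ n) (p : ℝ) (hp1 : 0 ≤ p) (hp2 : p < 1) :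
    ¬ ∃ u : EuclideanSpace ℝ (Fin n) → ℝ,
        ContDiff ℝ (⊤ : ℕ∞) u ∧
        (∀ x : EuclideanSpace ℝ (Fin n), 0 < u x) ∧
        (∀ x : EuclideanSpace ℝ (Fin n),
          -eLaplacian u x = u x ^ p / (1 + ‖x‖ ^ 2)) := by
  rintro ⟨u, hu, hpos, heq⟩
  have hn0 : (0 : ℝ) < n := by exact_mod_cast (by omega : 0 < n)
  set c : ℝ := 1 / (4 * n) with hc
  have hc0 : 0 < c := by positivity
  have hq : 0 < 1 - p := by linarith
  let φ : EuclideanSpace ℝ (Fin n) → ℝ :=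
    fun x => u x ^ (1 - p) / (1 - p) + c * Real.log (1 + ‖x‖ ^ 2)
  have hcont : Continuous φ := by
    refine Continuous.add ((hu.continuous.rpow_const fun x => Or.inl (hpos x).ne').div_const _)
      (continuous_const.mul (Continuous.log (by fun_prop) fun x => by positivity))
  have htend : Tendsto φ (cocompact _) atTop := by
    have h1 : Tendsto (fun x : EuclideanSpace ℝ (Fin n) => c * Real.log (1 + ‖x‖ ^ 2))
        (cocompact _) atTop :=
      (Real.tendsto_log_atTop.comp (tendsto_atTop_add_const_left _ 1
        ((tendsto_pow_atTop two_ne_zero).comp (tendsto_norm_cocompact_atTop)))).const_mul_atTop hc0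
    refine tendsto_atTop_mono (fun x => ?_) h1
    have := Real.rpow_pos_of_pos (hpos x) (1 - p)
    have : 0 ≤ u x ^ (1 - p) / (1 - p) := by positivity
    simp only [φ]
    linarith
  obtain ⟨x, hx⟩ := hcont.exists_forall_le htend
  have key : ∀ i : Fin n, 0 ≤ u x ^ (-p) *
      iteratedFDeriv ℝ 2 u x ![EuclideanSpace.single i 1, EuclideanSpace.single i 1]
      + 2 * c / (1 + ‖x‖ ^ 2) := by
    intro i
    set e : EuclideanSpace ℝ (Fin n) := EuclideanSpace.single i 1 with he
    have hline : ∀ s : ℝ, HasDerivAt (fun s : ℝ => x + s • e) e s := fun s => by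
      simpa using ((hasDerivAt_id s).smul_const e).const_add x
    have hnorm : ∀ s : ℝ, ‖x + s • e‖ ^ 2 = ‖x‖ ^ 2 + 2 * s * inner ℝ x e + s ^ 2 := fun s => by
      have he1 : ‖e‖ = 1 := by simp [he]
      rw [norm_add_sq_real, inner_smul_right, norm_smul, he1, mul_one, Real.norm_eq_abs, sq_abs]
      ring
    have hf' : ∀ s : ℝ, HasDerivAt (fun s : ℝ => u (x + s • e)) (fderiv ℝ u (x + s • e) e) s :=
      fun s => ((hu.differentiable (by simp)) _).hasFDerivAt.comp_hasDerivAt s (hline s)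
    have hd : Differentiable ℝ (fderiv ℝ u) :=
      (hu.fderiv_right (m := 1) (by norm_cast)).differentiable one_ne_zero
    have hf'' : HasDerivAt (fun s : ℝ => fderiv ℝ u (x + s • e) e)
        (fderiv ℝ (fderiv ℝ u) x e e) 0 := by
      have h := (hd (x + (0 : ℝ) • e)).hasFDerivAt.comp_hasDerivAt 0 (hline 0)
      have h' := h.clm_apply (hasDerivAt_const 0 e)
      simpa using h'
    have h := nonneg_of_isLocalMin_rpow_div_add_log (c := c) (x := inner ℝ x e) (r := ‖x‖ ^ 2)
      hp1 hp2 hc0.le (fun s => hpos (x + s • e)) hf' hf''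
      (fun s => by rw [← hnorm]; positivity)
      (Eventually.of_forall fun s => by
        simpa only [φ, hnorm, zero_smul, add_zero, mul_zero, zero_mul, ne_eq,
          OfNat.ofNat_ne_zero, not_false_eq_true, zero_pow] using hx (x + s • e))
    simpa [iteratedFDeriv_two_apply] using h
  have hsum := Finset.sum_nonneg fun i (_ : i ∈ Finset.univ) => key i
  rw [Finset.sum_add_distrib, ← Finset.mul_sum, Finset.sum_const, Finset.card_univ,
    Fintype.card_fin, nsmul_eq_mul] at hsum
  have hL : ∑ i : Fin n, iteratedFDeriv ℝ 2 u x
      ![EuclideanSpace.single i 1, EuclideanSpace.single i 1] = -(u x ^ p / (1 + ‖x‖ ^ 2)) := by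
    rw [← heq x, neg_neg, eLaplacian]
  have hone : u x ^ (-p) * u x ^ p = 1 := by
    rw [← Real.rpow_add (hpos x), neg_add_cancel, Real.rpow_zero]
  have hfin : u x ^ (-p) * -(u x ^ p / (1 + ‖x‖ ^ 2)) + n * (2 * c / (1 + ‖x‖ ^ 2))
      = -(1 / 2) / (1 + ‖x‖ ^ 2) := by
    rw [mul_neg, ← mul_div_assoc, hone, hc]
    field_simp
    norm_num
  rw [hL, hfin] at hsum
  have : 0 < (1 / 2) / (1 + ‖x‖ ^ 2) := by positivity
  rw [neg_div] at hsum
  linarith
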